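/- For all nonzero real numbers a and b, the integral ∫₀^{π/2} ln(a²·cos²φ + b²·sin²φ) dφ equals π·ln((|a|+|b|)/2). -/

import Mathlib

open Real

lemma aux_int (k : ℝ) (hk : |k| < 1) :
    ∫ θ in (0:ℝ)..π, Real.log (1 - 2 * k * cos θ + k ^ 2) = 0 := by
  have hpos : ∀ θ : ℝ, 0 < 1 - 2 * k * cos θ + k ^ 2 := by
    intro θ
    have h1 := abs_lt.1 hk
    rcases le_total 0 k with h0 | h0
    · nlinarith [mul_nonneg h0 (sub_nonneg.2 (cos_le_one θ)), pow_pos (sub_pos.2 h1.2) 2]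
    · have h2 : 0 < 1 + k := by linarith
      have h3 : 0 ≤ 1 + cos θ := by linarith [neg_one_le_cos θ]
      nlinarith [mul_nonneg (neg_nonneg.2 h0) h3, pow_pos h2 2]
  have hcont : Continuous (fun θ : ℝ => Real.log (1 - 2 * k * cos θ + k ^ 2)) :=
    Continuous.log (by fun_prop) (fun θ => (hpos θ).ne')
  have h := circleAverage_log_norm_sub_const₀ (a := (k : ℂ)) (by simpa using hk)
  rw [circleAverage_def] at h
  have e : ∀ θ : ℝ, Real.log ‖circleMap 0 1 θ - (k : ℂ)‖
      = Real.log (1 - 2 * k * cos θ + k ^ 2) / 2 := by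
    intro θ
    rw [← Real.log_sqrt (hpos θ).le, Complex.norm_def, Complex.normSq_apply]
    congr 2
    simp [circleMap, Complex.exp_ofReal_mul_I_re, Complex.exp_ofReal_mul_I_im]
    nlinarith [sin_sq_add_cos_sq θ]
  simp only [e] at h
  rw [intervalIntegral.integral_div] at h
  have h2 : ∫ θ in (0:ℝ)..(2 * π), Real.log (1 - 2 * k * cos θ + k ^ 2) = 0 := by
    have := pi_pos
    simpa [this.ne'] using h
  have hs := intervalIntegral.integral_comp_sub_left
    (fun θ : ℝ => Real.log (1 - 2 * k * cos θ + k ^ 2)) (a := 0) (b := π) (2 * π)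
  simp only [cos_two_pi_sub, sub_zero] at hs
  rw [show 2 * π - π = π by ring] at hs
  have ha := intervalIntegral.integral_add_adjacent_intervals
    (hcont.intervalIntegrable (μ := MeasureTheory.volume) 0 π) (hcont.intervalIntegrable π (2 * π))
  linarith

/-- For all nonzero real numbers `a` and `b`,
`∫₀^{π/2} ln(a²·cos²φ + b²·sin²φ) dφ = π·ln((|a|+|b|)/2)`. -/
theorem integral_log_quadratic_trig (a b : ℝ) (ha : a ≠ 0) (hb : b ≠ 0) :
    ∫ φ in (0:ℝ)..(Real.pi / 2),
        Real.log (a ^ 2 * Real.cos φ ^ 2 + b ^ 2 * Real.sin φ ^ 2)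
      = Real.pi * Real.log ((|a| + |b|) / 2) := by
  rw [← sq_abs a, ← sq_abs b]
  have hA := abs_pos.2 ha
  have hB := abs_pos.2 hb
  generalize |a| = A at *
  generalize |b| = B at *
  have hs : 0 < A + B := by linarith
  obtain ⟨k, hkd⟩ : ∃ k, k = (B - A) / (A + B) := ⟨_, rfl⟩
  have hk : |k| < 1 := by
    rw [hkd, abs_lt, lt_div_iff₀ hs, div_lt_iff₀ hs]; constructor <;> linarith
  have hkm : k * (A + B) = B - A := by rw [hkd]; field_simp
  have e : ∀ φ : ℝ, Real.log (A ^ 2 * cos φ ^ 2 + B ^ 2 * sin φ ^ 2)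
      = 2 * Real.log ((A + B) / 2) + Real.log (1 - 2 * k * cos (2 * φ) + k ^ 2) := by
    intro φ
    have hpos : 0 < A ^ 2 * cos φ ^ 2 + B ^ 2 * sin φ ^ 2 := by
      rcases eq_or_ne (cos φ) 0 with h | h
      · have : sin φ ^ 2 = 1 := by nlinarith [sin_sq_add_cos_sq φ]
        rw [h, this]; positivity
      · positivity
    have heq : A ^ 2 * cos φ ^ 2 + B ^ 2 * sin φ ^ 2
        = ((A + B) / 2) ^ 2 * (1 - 2 * k * cos (2 * φ) + k ^ 2) := by
      rw [cos_two_mul, sin_sq]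
      linear_combination (-(k * (A + B) + (B - A)) / 4
        + (2 * cos φ ^ 2 - 1) * (A + B) / 2) * hkm
    have hne : 1 - 2 * k * cos (2 * φ) + k ^ 2 ≠ 0 := by
      intro h; rw [heq, h] at hpos; simp at hpos
    rw [heq, Real.log_mul (by positivity) hne, Real.log_pow]; norm_num
  have hi : IntervalIntegrable (fun φ : ℝ => Real.log (1 - 2 * k * cos (2 * φ) + k ^ 2))
      MeasureTheory.volume 0 (π / 2) := by
    apply Continuous.intervalIntegrable
    refine Continuous.log (by fun_prop) (fun φ => ?_)
    have h1 := abs_lt.1 hk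
    have : 0 < 1 - k ^ 2 := by nlinarith
    intro h
    nlinarith [sq_nonneg (k - cos (2 * φ)), sin_sq_add_cos_sq (2 * φ), cos_le_one (2 * φ),
      neg_one_le_cos (2 * φ), sq_nonneg (1 - k * cos (2 * φ))]
  simp only [e]
  rw [intervalIntegral.integral_add (by simp) hi,
    intervalIntegral.integral_comp_mul_left
      (fun θ => Real.log (1 - 2 * k * cos θ + k ^ 2)) two_ne_zero]
  rw [show 2 * (π / 2) = π by ring, mul_zero, aux_int k hk]
  simp
  ring
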